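/- arXiv:0708.3434 — 9 statements merged into one kernel-verified Lean document; each statement's English description precedes it below -/
import Mathlib

section
/- Let p, q be complex polynomials with q ≠ 0 and p, q coprime, and let f(z) = p(z)/q(z). Suppose f is odd, i.e. p(-z)·q(z) = -p(z)·q(-z) for all z ∈ ℂ, and suppose the image of the upper half plane U under f equals U (f(U) = U). Then there exist a natural number N and nonnegative real numbers a, b and A₁,…,A_N, B₁,…,B_N such that for every z ∈ U, f(z) = a·z - b/z - ∑_{j=1}^{N} B_j·z/(z² - A_j). -/
open Polynomial Filter Topology in
theorem osup_angle (c : ℂ) (hc : c ≠ 0) (m : ℕ) (hm : 1 ≤ m)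
    (h : ∀ u : ℂ, 0 < u.im → 0 ≤ (c / u ^ m).im) : m = 1 ∧ c.im = 0 ∧ c.re ≤ 0 := by
  rcases Nat.lt_or_ge m 2 with h2 | h2
  · have hm1 : m = 1 := by omega
    subst hm1
    have key : ∀ s : ℝ, 0 ≤ c.im * s - c.re := by
      intro s
      have := h ⟨s, 1⟩ (by simp)
      rw [pow_one, Complex.div_im] at this
      have hn : 0 < Complex.normSq ⟨s, 1⟩ := by
        rw [Complex.normSq_mk]; nlinarith [sq_nonneg s]
      simp only at this
      rw [← sub_div] at this
      have := (div_nonneg_iff.1 this)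
      rcases this with h | h
      · linarith [h.1]
      · linarith [h.2]
    have him : c.im = 0 := by
      by_contra hne
      have := key ((c.re - 1) / c.im)
      rw [mul_div_cancel₀ _ hne] at this
      linarith
    refine ⟨rfl, him, ?_⟩
    have := key 0
    linarith
  · exfalso
    have hm0 : (0 : ℝ) < m := by positivity
    have hm2 : (2 : ℝ) ≤ m := by exact_mod_cast h2
    have key : ∀ α : ℝ, 0 < α → α < 2 * Real.pi →
        0 ≤ c.im * Real.cos α - c.re * Real.sin α := by
      intro α h0 h1
      have := h (Complex.exp ((α / m : ℝ) * Complex.I)) (by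
        rw [Complex.exp_ofReal_mul_I_im]
        apply Real.sin_pos_of_pos_of_lt_pi (by positivity)
        rw [div_lt_iff₀ hm0]
        nlinarith [Real.pi_pos])
      rw [← Complex.exp_nat_mul, div_eq_mul_inv, ← Complex.exp_neg] at this
      have e : -((m : ℂ) * (((α / m : ℝ) : ℂ) * Complex.I)) = ((-α : ℝ) : ℂ) * Complex.I := by
        have : (m : ℂ) ≠ 0 := by exact_mod_cast hm0.ne'
        push_cast
        field_simp
      rw [e, Complex.mul_im, Complex.exp_ofReal_mul_I_im, Complex.exp_ofReal_mul_I_re,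
        Real.sin_neg, Real.cos_neg] at this
      linarith
    have hpi := Real.pi_pos
    have a1 := key Real.pi (by linarith) (by linarith)
    have a2 := key (Real.pi / 2) (by linarith) (by linarith)
    have a3 := key (Real.pi / 2 + Real.pi) (by linarith) (by linarith)
    have a4 := key (Real.pi / 3) (by linarith) (by linarith)
    rw [Real.sin_add_pi, Real.cos_add_pi] at a3
    simp at a1 a2 a3
    have hre : c.re = 0 := le_antisymm a2 a3
    rw [hre, Real.cos_pi_div_three] at a4
    apply hc
    apply Complex.ext
    · exact hre
    · simp; linarith

open Polynomial Filter Topology in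
/-- Poles of a self map of the upper half plane. -/
theorem osup_pole (p h : ℂ[X]) (x : ℂ) (hx : x.im = 0) (m : ℕ) (hm : 1 ≤ m)
    (hp : p.eval x ≠ 0) (hh : h.eval x ≠ 0)
    (hpos : ∀ z : ℂ, 0 < z.im → 0 < (p.eval z / ((z - x) ^ m * h.eval z)).im) :
    m = 1 ∧ (p.eval x / h.eval x).im = 0 ∧ (p.eval x / h.eval x).re ≤ 0 := by
  apply osup_angle _ (div_ne_zero hp hh) m hm
  intro u hu
  have hc : ContinuousAt (fun t : ℝ => (p.eval (x + t * u) / h.eval (x + t * u) / u ^ m).im) 0 := by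
    apply Complex.continuous_im.continuousAt.comp
    apply ContinuousAt.div_const
    apply ContinuousAt.div
    · exact (by fun_prop : Continuous (fun t : ℝ => p.eval (x + t * u))).continuousAt
    · exact (by fun_prop : Continuous (fun t : ℝ => h.eval (x + t * u))).continuousAt
    · simpa using hh
  have hc' : Tendsto (fun t : ℝ => (p.eval (x + t * u) / h.eval (x + t * u) / u ^ m).im)
      (𝓝[>] 0) (𝓝 ((p.eval x / h.eval x / u ^ m).im)) := by
    have := hc.tendsto.mono_left (nhdsWithin_le_nhds (s := Set.Ioi 0))
    simpa using this
  apply ge_of_tendsto hc'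
  filter_upwards [self_mem_nhdsWithin] with t ht
  have ht : 0 < t := ht
  have h1 := hpos (x + t * u) (by simp [hx]; positivity)
  have e : p.eval (x + t * u) / h.eval (x + t * u) / u ^ m
      = ((t ^ m : ℝ) : ℂ) * (p.eval (x + t * u) / ((x + t * u - x) ^ m * h.eval (x + t * u))) := by
    have : (t : ℂ) ^ m ≠ 0 := by
      apply pow_ne_zero; exact_mod_cast ht.ne'
    rw [add_sub_cancel_left, mul_pow]
    push_cast
    rw [mul_assoc, ← mul_div_assoc, mul_div_mul_left _ _ this, div_div, mul_comm (u ^ m)]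
  rw [e, Complex.im_ofReal_mul]
  positivity

open Polynomial Filter Topology in
/-- Behaviour at infinity. -/
theorem osup_inf (d : ℂ[X]) (S : Finset ℂ) (c : ℂ → ℂ)
    (hpos : ∀ z : ℂ, 0 < z.im → 0 < (d.eval z + ∑ i ∈ S, c i / (z - i)).im)
    (hd : 1 ≤ d.natDegree) :
    d.natDegree = 1 ∧ d.leadingCoeff.im = 0 ∧ 0 ≤ d.leadingCoeff.re := by
  have hd0 : d ≠ 0 := by rintro rfl; simp at hd
  set k := d.natDegree with hk
  have main : ∀ u : ℂ, 0 < u.im → 0 ≤ (d.leadingCoeff * u ^ k).im := by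
    intro u hu
    have hu0 : u ≠ 0 := by rintro rfl; simp at hu
    have hc : ContinuousAt (fun s : ℝ => (d.reverse.eval (s * u⁻¹) * u ^ k
        + (s : ℂ) ^ (k + 1) * ∑ i ∈ S, c i / (u - s * i)).im) 0 := by
      apply Complex.continuous_im.continuousAt.comp
      apply ContinuousAt.add
      · exact (by fun_prop : Continuous (fun s : ℝ => d.reverse.eval (s * u⁻¹) * u ^ k)).continuousAt
      · apply ContinuousAt.mul
        · fun_prop
        · apply tendsto_finsetSum
          intro i _
          apply ContinuousAt.div
          · fun_prop
          · fun_prop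
          · simpa using hu0
    have hc' := hc.tendsto.mono_left (nhdsWithin_le_nhds (s := Set.Ioi 0))
    have e0 : (d.reverse.eval (((0 : ℝ) : ℂ) * u⁻¹) * u ^ k
        + ((0 : ℝ) : ℂ) ^ (k + 1) * ∑ i ∈ S, c i / (u - ((0 : ℝ) : ℂ) * i)) = d.leadingCoeff * u ^ k := by
      simp [← Polynomial.coeff_zero_eq_eval_zero]
    rw [e0] at hc'
    apply ge_of_tendsto hc'
    filter_upwards [self_mem_nhdsWithin] with s hs
    have hs : 0 < s := hs
    have hs0 : (s : ℂ) ≠ 0 := by exact_mod_cast hs.ne'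
    have h1 := hpos (((s⁻¹ : ℝ) : ℂ) * u) (by rw [Complex.im_ofReal_mul]; positivity)
    have e1 : d.eval (((s⁻¹ : ℝ) : ℂ) * u) = d.reverse.eval (s * u⁻¹) * ((s : ℂ)⁻¹ * u) ^ k := by
      let x : Units ℂ := Units.mk0 ((s : ℂ)⁻¹ * u) (mul_ne_zero (inv_ne_zero hs0) hu0)
      have hx : Invertible ((s : ℂ)⁻¹ * u) := invertibleOfNonzero (mul_ne_zero (inv_ne_zero hs0) hu0)
      have := Polynomial.eval₂_reverse_mul_pow (RingHom.id ℂ) ((s : ℂ)⁻¹ * u) d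
      rw [invOf_eq_inv, mul_inv, inv_inv] at this
      simp only [Polynomial.eval₂_id] at this
      push_cast
      exact this.symm
    have e2 : d.reverse.eval (s * u⁻¹) * u ^ k
        + (s : ℂ) ^ (k + 1) * ∑ i ∈ S, c i / (u - s * i)
        = ((s ^ k : ℝ) : ℂ) * (d.eval (((s⁻¹ : ℝ) : ℂ) * u)
          + ∑ i ∈ S, c i / (((s⁻¹ : ℝ) : ℂ) * u - i)) := by
      rw [e1, mul_add, mul_pow]
      congr 1
      · push_cast
        have : (s : ℂ) ^ k ≠ 0 := pow_ne_zero _ hs0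
        rw [inv_pow]
        field_simp
      · push_cast
        rw [pow_succ, mul_assoc, Finset.mul_sum]
        congr 1
        apply Finset.sum_congr rfl
        intro i _
        have : (s : ℂ)⁻¹ * u - i = (u - s * i) / s := by field_simp
        rw [this, div_div_eq_mul_div]
        ring
    rw [e2, Complex.im_ofReal_mul]
    positivity
  have hl : d.leadingCoeff ≠ 0 := by simpa using hd0
  have := osup_angle (d.leadingCoeff * (-1) ^ k) (mul_ne_zero hl (by simp)) k hd (by
    intro u hu
    have hu0 : u ≠ 0 := by rintro rfl; simp at hu
    have := main (-u⁻¹) (by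
      rw [Complex.neg_im, Complex.inv_im, neg_div, neg_neg]
      exact div_pos hu (Complex.normSq_pos.2 hu0))
    rw [neg_pow, inv_pow, ← mul_assoc, ← div_eq_mul_inv] at this
    exact this)
  obtain ⟨h1, h2, h3⟩ := this
  rw [h1] at h2 h3
  simp at h2 h3
  exact ⟨h1, h2, h3⟩

open Polynomial Filter Topology in
theorem odd_selfmap_upper_half_plane_form
    (p q : Polynomial ℂ) (hq : q ≠ 0) (hcop : IsCoprime p q)
    (hodd : ∀ z : ℂ, p.eval (-z) * q.eval z = -(p.eval z * q.eval (-z)))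
    (himg : (fun z : ℂ => p.eval z / q.eval z) '' {z : ℂ | 0 < z.im}
      = {z : ℂ | 0 < z.im}) :
    ∃ (N : ℕ) (a b : ℝ) (A B : Fin N → ℝ),
      0 ≤ a ∧ 0 ≤ b ∧ (∀ j, 0 ≤ A j) ∧ (∀ j, 0 ≤ B j) ∧
      ∀ z ∈ {z : ℂ | 0 < z.im},
        p.eval z / q.eval z
          = (a : ℂ) * z - (b : ℂ) / z
            - ∑ j : Fin N, (B j : ℂ) * z / (z ^ 2 - (A j : ℂ)) := by
  have hpos : ∀ z : ℂ, 0 < z.im → 0 < (p.eval z / q.eval z).im := by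
    intro z hz
    have : p.eval z / q.eval z ∈ {z : ℂ | 0 < z.im} := by
      rw [← himg]; exact ⟨z, hz, rfl⟩
    exact this
  have hqU : ∀ z : ℂ, 0 < z.im → q.eval z ≠ 0 := by
    intro z hz h0
    have := hpos z hz
    simp [h0] at this
  have hcop' : ∀ z : ℂ, q.eval z = 0 → p.eval z ≠ 0 := by
    intro z h0 h1
    obtain ⟨a, b, hab⟩ := hcop
    have := congrArg (Polynomial.eval z) hab
    simp [h0, h1] at this
  have hqL : ∀ z : ℂ, 0 < z.im → q.eval (-z) ≠ 0 := by
    intro z hz h0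
    have := hodd z
    rw [h0, mul_zero, neg_zero] at this
    exact (mul_ne_zero (hcop' _ h0) (hqU z hz)) this
  have hreal : ∀ x : ℂ, q.eval x = 0 → x.im = 0 := by
    intro x hx
    rcases lt_trichotomy x.im 0 with h | h | h
    · exact absurd hx (by simpa using hqL (-x) (by simpa using h))
    · exact h
    · exact absurd hx (hqU x h)
  have hpole : ∀ x : ℂ, q.eval x = 0 → ∃ h : ℂ[X], q = (X - C x) * h ∧ h.eval x ≠ 0 ∧
      (p.eval x / h.eval x).im = 0 ∧ (p.eval x / h.eval x).re ≤ 0 := by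
    intro x hx
    obtain ⟨h, hqh, hh⟩ := Polynomial.exists_eq_pow_rootMultiplicity_mul_and_not_dvd q hq x
    have hh' : h.eval x ≠ 0 := by rwa [Ne, ← Polynomial.IsRoot.def, ← Polynomial.dvd_iff_isRoot]
    have hm : 1 ≤ q.rootMultiplicity x := (Polynomial.rootMultiplicity_pos hq).2 hx
    have := osup_pole p h x (hreal x hx) _ hm (hcop' x hx) hh' (by
      intro z hz
      have := hpos z hz
      rw [hqh] at this
      simpa using this)
    obtain ⟨h1, h2, h3⟩ := this
    rw [h1, pow_one] at hqh
    exact ⟨h, hqh, hh', h2, h3⟩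
  set S : Finset ℂ := q.roots.toFinset with hS
  have hSmem : ∀ x, x ∈ S ↔ q.eval x = 0 := by
    intro x; rw [hS, Multiset.mem_toFinset, Polynomial.mem_roots hq]; rfl
  have hnodup : q.roots.Nodup := by
    rw [Multiset.nodup_iff_count_le_one]
    intro x
    rw [Polynomial.count_roots]
    by_contra hcon
    push Not at hcon
    have hx : q.eval x = 0 := (Polynomial.rootMultiplicity_pos hq).1 (by omega)
    obtain ⟨h, hqh, hh, -⟩ := hpole x hx
    have hdv : (X - C x) ^ 2 ∣ q := (Polynomial.le_rootMultiplicity_iff hq).1 hcon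
    obtain ⟨g, hg⟩ := hdv
    have : h = (X - C x) * g := by
      apply mul_left_cancel₀ (Polynomial.X_sub_C_ne_zero x)
      rw [← hqh, hg]; ring
    rw [this] at hh
    simp at hh
  have hqnodal : q = C q.leadingCoeff * Lagrange.nodal S id := by
    have h1 := (IsAlgClosed.splits q).eq_prod_roots
    conv_lhs => rw [h1]
    congr 1
    rw [Lagrange.nodal, Finset.prod, hS, Multiset.toFinset_val, hnodup.dedup]
    rfl
  have hlead : q.leadingCoeff ≠ 0 := by simpa using hq
  have hdeg : (p % q).degree < S.card := by
    refine lt_of_lt_of_eq (EuclideanDomain.mod_lt p hq) ?_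
    conv_lhs => rw [hqnodal]
    rw [Polynomial.degree_C_mul hlead, Lagrange.degree_nodal]
  set c : ℂ → ℂ := fun i => Lagrange.nodalWeight S id i * (p % q).eval i / q.leadingCoeff with hc
  set d := p / q with hd
  have hform : ∀ z : ℂ, q.eval z ≠ 0 → p.eval z / q.eval z = d.eval z + ∑ i ∈ S, c i / (z - i) := by
    intro z hz
    have h1 : p.eval z = q.eval z * d.eval z + (p % q).eval z := by
      conv_lhs => rw [← EuclideanDomain.div_add_mod p q]
      simp [hd]
    have h2 : (p % q) = Lagrange.interpolate S id (fun i => (p % q).eval i) :=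
      Lagrange.eq_interpolate (Function.injective_id.injOn) hdeg
    have h3 : (p % q).eval z = (Lagrange.nodal S id).eval z *
        ∑ i ∈ S, Lagrange.nodalWeight S id i * (z - i)⁻¹ * (p % q).eval i := by
      conv_lhs => rw [h2]
      rw [Lagrange.eval_interpolate_not_at_node]
      · rfl
      · intro i hi hzi
        apply hz
        rw [hzi]
        exact (hSmem i).1 hi
    have h4 : q.eval z = q.leadingCoeff * (Lagrange.nodal S id).eval z := by
      conv_lhs => rw [hqnodal]
      simp
    have h5 : (Lagrange.nodal S id).eval z ≠ 0 := by
      intro h; rw [h, mul_zero] at h4; exact hz h4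
    have h6 : (p % q).eval z / q.eval z = ∑ i ∈ S, c i / (z - i) := by
      rw [h3, h4, mul_comm q.leadingCoeff, mul_div_mul_left _ _ h5, Finset.sum_div]
      apply Finset.sum_congr rfl
      intro i _
      simp only [hc, div_eq_mul_inv]
      ring
    rw [h1, add_div, mul_div_cancel_left₀ _ hz, h6]
  have hcneg : ∀ i ∈ S, (c i).im = 0 ∧ (c i).re ≤ 0 := by
    intro i hi
    have hi0 := (hSmem i).1 hi
    obtain ⟨h, hqh, hh, h1, h2⟩ := hpole i hi0
    have e : c i = p.eval i / h.eval i := by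
      have e1 : (p % q).eval i = p.eval i := by
        conv_rhs => rw [← EuclideanDomain.div_add_mod p q]
        simp [hi0]
      have e2 : h = C q.leadingCoeff * Lagrange.nodal (S.erase i) id := by
        apply mul_left_cancel₀ (Polynomial.X_sub_C_ne_zero i)
        rw [← hqh]
        conv_lhs => rw [hqnodal, Lagrange.nodal_eq_mul_nodal_erase hi]
        simp only [id]
        ring
      simp only [hc]
      rw [e1, e2, Lagrange.nodalWeight_eq_eval_nodal_erase_inv, Polynomial.eval_mul, Polynomial.eval_C]
      simp only [id, div_eq_mul_inv, mul_inv]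
      ring
    rw [e]; exact ⟨h1, h2⟩
  have hinf := osup_inf d S c (fun z hz => by
    rw [← hform z (hqU z hz)]; exact hpos z hz)
  obtain ⟨a, b0, ha, hdab⟩ : ∃ (a : ℝ) (b0 : ℂ), 0 ≤ a ∧ ∀ z, d.eval z = a * z + b0 := by
    by_cases h : 1 ≤ d.natDegree
    · obtain ⟨h1, h2, h3⟩ := hinf h
      refine ⟨d.leadingCoeff.re, d.coeff 0, h3, ?_⟩
      intro z
      have e : ((d.leadingCoeff.re : ℝ) : ℂ) = d.coeff 1 := by
        rw [← h1]
        apply Complex.ext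
        · simp
        · simpa using h2.symm
      rw [e]
      conv_lhs => rw [Polynomial.eq_X_add_C_of_natDegree_le_one h1.le]
      simp
    · refine ⟨0, d.coeff 0, le_rfl, ?_⟩
      intro z
      conv_lhs => rw [Polynomial.eq_C_of_natDegree_eq_zero (by omega : d.natDegree = 0)]
      simp
  let φ := S.equivFin
  refine ⟨S.card, a, 0, fun j => ((φ.symm j : ℂ).re) ^ 2, fun j => -(c (φ.symm j)).re, ha, le_rfl,
    fun j => sq_nonneg _, fun j => ?_, ?_⟩
  · have := (hcneg _ (φ.symm j).2).2
    linarith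
  intro z hz
  have hz : 0 < z.im := hz
  have f1 := hform z (hqU z hz)
  have f2 := hform (-z) (hqL z hz)
  have f3 : p.eval (-z) / q.eval (-z) = -(p.eval z / q.eval z) := by
    rw [← neg_div, div_eq_div_iff (hqL z hz) (hqU z hz), hodd z]; ring
  rw [f3, hdab] at f2
  rw [hdab] at f1
  have hsum : ∑ j : Fin S.card, ((-(c (φ.symm j)).re : ℝ) : ℂ) * z /
      (z ^ 2 - ((((φ.symm j : ℂ).re) ^ 2 : ℝ) : ℂ)) = ∑ i ∈ S, -(c i) * z / (z ^ 2 - i ^ 2) := by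
    rw [← Finset.sum_coe_sort S, ← φ.symm.sum_comp]
    apply Finset.sum_congr rfl
    intro j _
    have hm := (φ.symm j).2
    have r1 : ((c (φ.symm j)).re : ℂ) = c (φ.symm j) := by
      apply Complex.ext
      · simp
      · simpa using (hcneg _ hm).1.symm
    have r2 : ((φ.symm j : ℂ).re : ℂ) = (φ.symm j : ℂ) := by
      apply Complex.ext
      · simp
      · simpa using (hreal _ ((hSmem _).1 hm)).symm
    push_cast
    rw [r1, r2]
  rw [hsum]
  have hs2 : ∑ i ∈ S, -(c i) * z / (z ^ 2 - i ^ 2)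
      = -((∑ i ∈ S, c i / (z - i)) - ∑ i ∈ S, c i / (-z - i)) / 2 := by
    rw [← Finset.sum_sub_distrib, ← Finset.sum_neg_distrib, Finset.sum_div]
    apply Finset.sum_congr rfl
    intro i hi
    have n1 : z - i ≠ 0 := by
      intro h
      have := hreal i ((hSmem i).1 hi)
      rw [sub_eq_zero.1 h] at hz
      linarith
    have n2 : z + i ≠ 0 := by
      intro h
      have := hreal i ((hSmem i).1 hi)
      rw [eq_neg_of_add_eq_zero_left h] at hz
      simp at hz
      linarith
    have e1 : z ^ 2 - i ^ 2 = (z - i) * (z + i) := by ring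
    have e2 : -z - i = -(z + i) := by ring
    rw [e1, e2]
    field_simp
    ring
  rw [hs2]
  push_cast
  rw [zero_div]
  linear_combination f1 / 2 - f2 / 2
end

section
/- Let N be a natural number and let a, b and A₁,…,A_N, B₁,…,B_N be nonnegative real numbers, not all of a, b, B₁,…,B_N equal to zero. Define f(z) = a·z - b/z - ∑_{j=1}^{N} B_j·z/(z² - A_j). Then the image of the upper half plane U under f equals U, i.e. {f(z) : z ∈ U} = U. (Note that for z ∈ U one has z ≠ 0 and z² - A_j ≠ 0 for every j, so f is well defined on U.) -/
open Polynomial in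
theorem fm_sub_ne (z : ℂ) (hz : z.im ≠ 0) (A : ℝ) (hA : 0 ≤ A) : z ^ 2 - (A : ℂ) ≠ 0 := by
  intro h
  have h1 := congrArg Complex.re h
  have h2 := congrArg Complex.im h
  simp [pow_two] at h1 h2
  have h3 : z.re = 0 := by
    have : z.im * z.re = 0 := by linarith
    rcases mul_eq_zero.1 this with h | h
    · exact absurd h hz
    · exact h
  rw [h3] at h1
  have := mul_self_pos.2 hz
  linarith

theorem fm_term_im (z : ℂ) (A B : ℝ) :
    ((B : ℂ) * z / (z ^ 2 - (A : ℂ))).im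
      = -(z.im * (B * (Complex.normSq z + A) / Complex.normSq (z ^ 2 - (A : ℂ)))) := by
  rw [Complex.div_im]
  simp only [Complex.normSq_apply z]
  simp [pow_two]
  ring

theorem fm_im (N : ℕ) (a b : ℝ) (A B : Fin N → ℝ)
    (ha : 0 ≤ a) (hb : 0 ≤ b) (hA : ∀ j, 0 ≤ A j) (hB : ∀ j, 0 ≤ B j)
    (hnz : ¬(a = 0 ∧ b = 0 ∧ ∀ j, B j = 0)) (z : ℂ) (hz : z.im ≠ 0) :
    ∃ K : ℝ, 0 < K ∧ ((a : ℂ) * z - (b : ℂ) / z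
        - ∑ j : Fin N, (B j : ℂ) * z / (z ^ 2 - (A j : ℂ))).im = z.im * K := by
  have hz0 : z ≠ 0 := by rintro rfl; simp at hz
  have hn : 0 < Complex.normSq z := Complex.normSq_pos.2 hz0
  have hd : ∀ j, 0 < Complex.normSq (z ^ 2 - (A j : ℂ)) :=
    fun j => Complex.normSq_pos.2 (fm_sub_ne z hz _ (hA j))
  have ht : ∀ j, 0 < (Complex.normSq z + A j) / Complex.normSq (z ^ 2 - (A j : ℂ)) :=
    fun j => div_pos (by linarith [hA j]) (hd j)
  have hterm : ∀ j, 0 ≤ B j * (Complex.normSq z + A j) / Complex.normSq (z ^ 2 - (A j : ℂ)) := by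
    intro j
    rw [mul_div_assoc]
    exact mul_nonneg (hB j) (ht j).le
  refine ⟨a + b / Complex.normSq z
    + ∑ j, B j * (Complex.normSq z + A j) / Complex.normSq (z ^ 2 - (A j : ℂ)), ?_, ?_⟩
  · have h2 : 0 ≤ b / Complex.normSq z := div_nonneg hb hn.le
    have h3 := Finset.sum_nonneg (fun j (_ : j ∈ Finset.univ) => hterm j)
    by_contra hcon
    apply hnz
    refine ⟨by linarith, ?_, ?_⟩
    · have : b / Complex.normSq z = 0 := by linarith
      rcases div_eq_zero_iff.1 this with h | h
      · exact h
      · exact absurd h hn.ne'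
    · intro j
      have h0 := (Finset.sum_eq_zero_iff_of_nonneg
        (fun j (_ : j ∈ Finset.univ) => hterm j)).1 (by linarith) j (Finset.mem_univ j)
      rw [mul_div_assoc] at h0
      rcases mul_eq_zero.1 h0 with h | h
      · exact h
      · exact absurd h (ht j).ne'
  · rw [Complex.sub_im, Complex.sub_im, Complex.im_sum]
    simp only [fm_term_im]
    rw [Complex.div_im, Finset.sum_neg_distrib, ← Finset.mul_sum]
    simp
    ring

open Polynomial in
theorem fm_rat (N : ℕ) (a b : ℝ) (A B : Fin N → ℝ) (hA : ∀ j, 0 ≤ A j) (s : Finset (Fin N)) :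
    ∃ P Q : ℝ[X], ∀ z : ℂ, z.im ≠ 0 → aeval z Q ≠ 0 ∧
      (a : ℂ) * z - (b : ℂ) / z - ∑ j ∈ s, (B j : ℂ) * z / (z ^ 2 - (A j : ℂ))
        = aeval z P / aeval z Q := by
  classical
  induction s using Finset.induction_on with
  | empty =>
    refine ⟨C a * X ^ 2 - C b, X, fun z hz => ?_⟩
    have hz0 : z ≠ 0 := by rintro rfl; simp at hz
    refine ⟨by simpa using hz0, ?_⟩
    simp
    field_simp
  | insert j s hj ih =>
    obtain ⟨P, Q, h⟩ := ih
    refine ⟨P * (X ^ 2 - C (A j)) - Q * (C (B j) * X), Q * (X ^ 2 - C (A j)), fun z hz => ?_⟩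
    obtain ⟨hQ, he⟩ := h z hz
    have hne := fm_sub_ne z hz _ (hA j)
    refine ⟨by simpa using ⟨hQ, hne⟩, ?_⟩
    have : (a : ℂ) * z - (b : ℂ) / z - ∑ j ∈ insert j s, (B j : ℂ) * z / (z ^ 2 - (A j : ℂ))
        = aeval z P / aeval z Q - (B j : ℂ) * z / (z ^ 2 - (A j : ℂ)) := by
      rw [Finset.sum_insert hj, ← he]; ring
    rw [this, div_sub_div _ _ hQ hne]
    simp

open Polynomial in
theorem fm_aeval_real (P : ℝ[X]) (z : ℂ) (hz : z.im = 0) :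
    aeval z P = ((P.eval z.re : ℝ) : ℂ) := by
  have : z = ((z.re : ℝ) : ℂ) := by apply Complex.ext <;> simp [hz]
  conv_lhs => rw [this]
  exact aeval_algebraMap_apply_eq_algebraMap_eval z.re P

open Polynomial in
theorem fm_surj (f : ℂ → ℂ) (hf : ∀ z : ℂ, z.im ≠ 0 → ∃ K : ℝ, 0 < K ∧ (f z).im = z.im * K)
    (P0 Q0 : ℝ[X])
    (h : ∀ z : ℂ, z.im ≠ 0 → aeval z Q0 ≠ 0 ∧ f z = aeval z P0 / aeval z Q0)
    (w : ℂ) (hw : 0 < w.im) : ∃ z : ℂ, 0 < z.im ∧ f z = w := by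
  classical
  have hQ0 : Q0 ≠ 0 := by
    rintro rfl
    exact (h Complex.I (by simp)).1 (by simp)
  obtain ⟨g, P, Q, hPg, hQg, hcop⟩ : ∃ g P Q : ℝ[X], P0 = g * P ∧ Q0 = g * Q ∧ IsCoprime P Q := by
    obtain ⟨P, hP⟩ := EuclideanDomain.gcd_dvd_left P0 Q0
    obtain ⟨Q, hQ⟩ := EuclideanDomain.gcd_dvd_right P0 Q0
    have hb := EuclideanDomain.gcd_eq_gcd_ab P0 Q0
    generalize EuclideanDomain.gcdA P0 Q0 = x at hb
    generalize EuclideanDomain.gcdB P0 Q0 = y at hb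
    generalize EuclideanDomain.gcd P0 Q0 = g at hb hP hQ
    have hg : g ≠ 0 := by
      rintro rfl
      exact hQ0 (by rw [hQ, zero_mul])
    refine ⟨g, P, Q, hP, hQ, x, y, mul_left_cancel₀ hg ?_⟩
    rw [hP, hQ] at hb
    linear_combination -hb
  have h' : ∀ z : ℂ, z.im ≠ 0 → aeval z Q ≠ 0 ∧ f z = aeval z P / aeval z Q := by
    intro z hz
    obtain ⟨h1, h2⟩ := h z hz
    rw [hQg, map_mul] at h1
    refine ⟨right_ne_zero_of_mul h1, ?_⟩
    rw [h2, hPg, hQg, map_mul, map_mul, mul_div_mul_left _ _ (left_ne_zero_of_mul h1)]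
  set R : ℂ[X] := P.map (algebraMap ℝ ℂ) - C w * Q.map (algebraMap ℝ ℂ) with hR
  have hdeg : 0 < R.degree := by
    by_contra hcon
    have hc : ∀ n, n ≠ 0 → Q.coeff n = 0 ∧ P.coeff n = 0 := by
      intro n hn
      have h0 : R.coeff n = 0 := coeff_eq_zero_of_degree_lt
        (lt_of_le_of_lt (not_lt.1 hcon) (by exact_mod_cast Nat.pos_of_ne_zero hn))
      simp only [hR, coeff_sub, coeff_map, coeff_C_mul] at h0
      have h1 := congrArg Complex.im h0
      have h2 := congrArg Complex.re h0
      simp at h1 h2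
      have hq : Q.coeff n = 0 := by
        rcases h1 with h | h
        · exact absurd h hw.ne'
        · exact h
      rw [hq] at h2
      exact ⟨hq, by simpa using h2⟩
    have hP : P = C (P.coeff 0) := by
      ext n
      rcases eq_or_ne n 0 with rfl | hn
      · simp
      · rw [(hc n hn).2, coeff_C_ne_zero hn]
    have hQ : Q = C (Q.coeff 0) := by
      ext n
      rcases eq_or_ne n 0 with rfl | hn
      · simp
      · rw [(hc n hn).1, coeff_C_ne_zero hn]
    obtain ⟨K, hK, hi⟩ := hf Complex.I (by simp)
    have h3 := (h' Complex.I (by simp)).2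
    rw [hP, hQ, aeval_C, aeval_C] at h3
    rw [h3] at hi
    simp [Complex.div_im] at hi
    linarith
  obtain ⟨z, hz⟩ := Complex.exists_root hdeg
  have hz' : aeval z P = w * aeval z Q := by
    have : R.eval z = 0 := hz
    simp only [hR, eval_sub, eval_mul, eval_C, eval_map_algebraMap] at this
    exact sub_eq_zero.1 this
  have hQz : aeval z Q ≠ 0 := by
    intro h0
    obtain ⟨u, v, huv⟩ := hcop
    have := congrArg (aeval z) huv
    rw [map_add, map_mul, map_mul, hz', h0] at this
    simp at this
  have him : z.im ≠ 0 := by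
    intro h0
    rw [fm_aeval_real P z h0, fm_aeval_real Q z h0] at hz'
    rw [fm_aeval_real Q z h0] at hQz
    have h1 := congrArg Complex.im hz'
    simp at h1
    rcases h1 with h1 | h1
    · exact hw.ne' h1
    · exact hQz (by rw [h1]; simp)
  have hfz : f z = w := by
    rw [(h' z him).2, hz', mul_div_assoc, div_self hQz, mul_one]
  obtain ⟨K, hK, hi⟩ := hf z him
  refine ⟨z, ?_, hfz⟩
  rw [hfz] at hi
  rw [hi] at hw
  exact (pos_iff_pos_of_mul_pos hw).2 hK


/-- A map of the form `f(z) = a z - b/z - ∑ Bⱼ z/(z² - Aⱼ)` with nonnegative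
coefficients, not all of `a, b, Bⱼ` zero, maps the upper half plane onto
itself. -/
theorem form_maps_upper_half_plane_onto
    (N : ℕ) (a b : ℝ) (A B : Fin N → ℝ)
    (ha : 0 ≤ a) (hb : 0 ≤ b) (hA : ∀ j, 0 ≤ A j) (hB : ∀ j, 0 ≤ B j)
    (hnz : ¬(a = 0 ∧ b = 0 ∧ ∀ j, B j = 0)) :
    (fun z : ℂ => (a : ℂ) * z - (b : ℂ) / z
        - ∑ j : Fin N, (B j : ℂ) * z / (z ^ 2 - (A j : ℂ))) '' {z : ℂ | 0 < z.im}
      = {z : ℂ | 0 < z.im} := by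
  have hf := fm_im N a b A B ha hb hA hB hnz
  ext w
  constructor
  · rintro ⟨z, hz, rfl⟩
    have hz' : 0 < z.im := hz
    obtain ⟨K, hK, hi⟩ := hf z hz'.ne'
    show 0 < Complex.im _
    rw [hi]
    exact mul_pos hz' hK
  · intro hw
    obtain ⟨P, Q, h⟩ := fm_rat N a b A B hA Finset.univ
    obtain ⟨z, hz, he⟩ := fm_surj (fun z : ℂ => (a : ℂ) * z - (b : ℂ) / z
        - ∑ j : Fin N, (B j : ℂ) * z / (z ^ 2 - (A j : ℂ))) hf P Q h w hw
    exact ⟨z, hz, he⟩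
end

section
/- Let p, q be complex polynomials with q ≠ 0, and suppose that p(z)·q(-z) = p(-z)·q(z) for all z ∈ ℂ (i.e. the rational function g = p/q is even). Then there exist complex polynomials P, Q with Q ≠ 0 such that p(z)·Q(z²) = P(z²)·q(z) for all z ∈ ℂ; that is, g(z) = h(z²) for the rational function h = P/Q. -/
open Polynomial in
theorem even_odd_decomp (f : Polynomial ℂ) : ∃ a b : Polynomial ℂ,
    ∀ z : ℂ, f.eval z = a.eval (z ^ 2) + z * b.eval (z ^ 2) := by
  induction f using Polynomial.induction_on' with
  | add f g hf hg =>
    obtain ⟨a, b, h⟩ := hf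
    obtain ⟨c, d, k⟩ := hg
    refine ⟨a + c, b + d, fun z => ?_⟩
    simp only [eval_add, h, k]
    ring
  | monomial n r =>
    obtain ⟨m, hm | hm⟩ := Nat.even_or_odd' n
    · refine ⟨monomial m r, 0, fun z => ?_⟩
      simp [hm, eval_monomial, pow_mul]
    · refine ⟨0, monomial m r, fun z => ?_⟩
      simp only [hm, eval_monomial, eval_zero, pow_succ, pow_mul]
      ring

/-- An even rational function `g = p/q` can be written as `g(z) = h(z²)` for a
rational function `h = P/Q`. -/
theorem even_rational_is_function_of_sq
    (p q : Polynomial ℂ) (hq : q ≠ 0)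
    (heven : ∀ z : ℂ, p.eval z * q.eval (-z) = p.eval (-z) * q.eval z) :
    ∃ (P Q : Polynomial ℂ), Q ≠ 0 ∧
      ∀ z : ℂ, p.eval z * Q.eval (z ^ 2) = P.eval (z ^ 2) * q.eval z := by
  obtain ⟨a, b, h⟩ := even_odd_decomp p
  obtain ⟨c, d, k⟩ := even_odd_decomp q
  have hQ : ∀ z : ℂ, (c ^ 2 - Polynomial.X * d ^ 2).eval (z ^ 2) = q.eval z * q.eval (-z) := by
    intro z
    simp only [k, Polynomial.eval_sub, Polynomial.eval_mul, Polynomial.eval_pow,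
      Polynomial.eval_X, neg_sq]
    ring
  have hP : ∀ z : ℂ, (a * c - Polynomial.X * (b * d)).eval (z ^ 2)
      = p.eval z * q.eval (-z) := by
    intro z
    have e := heven z
    simp only [h, k, Polynomial.eval_sub, Polynomial.eval_mul,
      Polynomial.eval_X, neg_sq] at e ⊢
    linear_combination (-1 / 2) * e
  refine ⟨a * c - Polynomial.X * (b * d), c ^ 2 - Polynomial.X * d ^ 2, ?_, ?_⟩
  · intro h0
    have h1 : q * q.comp (-Polynomial.X) = 0 := by
      apply Polynomial.funext
      intro z
      have := hQ z
      rw [h0] at this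
      simpa using this.symm
    rcases mul_eq_zero.mp h1 with h2 | h2
    · exact hq h2
    · apply hq
      apply Polynomial.funext
      intro z
      have := congrArg (Polynomial.eval (-z)) h2
      simpa using this
  · intro z
    rw [hQ, hP]
    ring
end

section
/- Let p, q be complex polynomials with q ≠ 0, and suppose p(-z)·q(z) = -p(z)·q(-z) for all z ∈ ℂ (i.e. the rational function f = p/q is odd). Then there exist complex polynomials P, Q with Q ≠ 0 such that for every z ∈ ℂ with z² + 1 ≠ 0 and q(z) ≠ 0, writing w = (z² - 1)/(z² + 1), one has (p(z)² - q(z)²)·Q(w) = P(w)·(p(z)² + q(z)²). In other words, φ ∘ f = f̃ ∘ φ for the rational function f̃ = P/Q, where φ(z) = (z² - 1)/(z² + 1); note that φ(f(z)) = (f(z)² - 1)/(f(z)² + 1) = (p(z)² - q(z)²)/(p(z)² + q(z)²). -/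
open Polynomial in
lemma even_expand (F : Polynomial ℂ) (h : ∀ z : ℂ, F.eval (-z) = F.eval z) :
    ∃ H : Polynomial ℂ, ∀ z : ℂ, F.eval z = H.eval (z ^ 2) := by
  refine ⟨contract 2 F, fun z => ?_⟩
  rw [← expand_eval]
  congr 1
  have hc : F.comp (C (-1) * X) = F := by
    apply Polynomial.funext
    intro z
    simp [h]
  ext n
  rw [coeff_expand (by norm_num)]
  split_ifs with hn
  · rw [coeff_contract (by norm_num), Nat.div_mul_cancel hn]
  · have h1 := congrArg (fun G => coeff G n) hc
    have ho : Odd n := by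
      rw [← Nat.not_even_iff_odd]
      exact fun he => hn he.two_dvd
    simp only [comp_C_mul_X_coeff, ho.neg_one_pow] at h1
    linear_combination (-1 / 2 : ℂ) * h1

open Polynomial in
lemma even_hom (F : Polynomial ℂ) (h : ∀ z : ℂ, F.eval (-z) = F.eval z) :
    ∃ N : ℕ, ∀ n, N ≤ n → ∃ G : Polynomial ℂ, ∀ z : ℂ, z ^ 2 + 1 ≠ 0 →
      G.eval ((z ^ 2 - 1) / (z ^ 2 + 1)) * (z ^ 2 + 1) ^ n = F.eval z := by
  obtain ⟨H, hH⟩ := even_expand F h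
  refine ⟨H.natDegree, fun n hn => ⟨∑ i ∈ Finset.range (n + 1),
    C (H.coeff i) * (C (1 / 2) * (1 + X)) ^ i * (C (1 / 2) * (1 - X)) ^ (n - i), fun z hz => ?_⟩⟩
  rw [hH, eval_eq_sum_range' (Nat.lt_succ_of_le hn), eval_finsetSum, Finset.sum_mul]
  apply Finset.sum_congr rfl
  intro i hi
  have hi' : i ≤ n := Nat.lt_succ_iff.mp (Finset.mem_range.mp hi)
  simp only [eval_mul, eval_pow, eval_C, eval_add, eval_sub, eval_one, eval_X]
  have e1 : (1 / 2 : ℂ) * (1 + (z ^ 2 - 1) / (z ^ 2 + 1)) = z ^ 2 / (z ^ 2 + 1) := by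
    field_simp; ring
  have e2 : (1 / 2 : ℂ) * (1 - (z ^ 2 - 1) / (z ^ 2 + 1)) = 1 / (z ^ 2 + 1) := by
    field_simp; ring
  obtain ⟨k, rfl⟩ := Nat.exists_eq_add_of_le hi'
  rw [e1, e2, Nat.add_sub_cancel_left, div_pow, div_pow, pow_add (z ^ 2 + 1)]
  field_simp
  simp

/-- An odd rational function `f = p/q` can be semi-conjugated by
`φ(z) = (z² - 1)/(z² + 1)` to a rational map `f̃ = P/Q`:
`φ ∘ f = f̃ ∘ φ`, stated in cross-multiplied form. -/
theorem odd_rational_semiconjugate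
    (p q : Polynomial ℂ) (hq : q ≠ 0)
    (hodd : ∀ z : ℂ, p.eval (-z) * q.eval z = -(p.eval z * q.eval (-z))) :
    ∃ (P Q : Polynomial ℂ), Q ≠ 0 ∧
      ∀ z : ℂ, z ^ 2 + 1 ≠ 0 → q.eval z ≠ 0 →
        (p.eval z ^ 2 - q.eval z ^ 2) * Q.eval ((z ^ 2 - 1) / (z ^ 2 + 1))
          = P.eval ((z ^ 2 - 1) / (z ^ 2 + 1)) * (p.eval z ^ 2 + q.eval z ^ 2) := by
  obtain ⟨r, hr⟩ : ∃ r : Polynomial ℂ, r = q.comp (-Polynomial.X) := ⟨_, rfl⟩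
  have hre : ∀ z, r.eval z = q.eval (-z) := fun z => by simp [hr]
  have hr0 : r ≠ 0 := by
    intro h0
    apply hq
    apply Polynomial.funext
    intro z
    have := hre (-z)
    rw [h0] at this
    simpa using this.symm
  have hsq : ∀ z : ℂ, (p.eval (-z) * q.eval z) ^ 2 = (p.eval z * q.eval (-z)) ^ 2 := fun z => by
    rw [hodd z]; ring
  obtain ⟨N1, h1⟩ := even_hom ((p * r) ^ 2 - (q * r) ^ 2) (fun z => by
    simp only [Polynomial.eval_sub, Polynomial.eval_mul, Polynomial.eval_pow, hre, neg_neg]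
    linear_combination hsq z)
  obtain ⟨N2, h2⟩ := even_hom ((p * r) ^ 2 + (q * r) ^ 2) (fun z => by
    simp only [Polynomial.eval_add, Polynomial.eval_mul, Polynomial.eval_pow, hre, neg_neg]
    linear_combination hsq z)
  obtain ⟨P, hP⟩ := h1 (max N1 N2) (le_max_left _ _)
  obtain ⟨Q, hQ⟩ := h2 (max N1 N2) (le_max_right _ _)
  refine ⟨P, Q, ?_, ?_⟩
  · rintro rfl
    have key : (r ^ 2 * ((p + Polynomial.C Complex.I * q) * (p - Polynomial.C Complex.I * q)))
        * (Polynomial.X ^ 2 + 1) = 0 := by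
      apply Polynomial.funext
      intro z
      by_cases hz : z ^ 2 + 1 = 0
      · simp [hz]
      · have := hQ z hz
        simp only [Polynomial.eval_zero, zero_mul, Polynomial.eval_add, Polynomial.eval_mul,
          Polynomial.eval_pow] at this
        simp only [Polynomial.eval_zero, Polynomial.eval_add, Polynomial.eval_mul,
          Polynomial.eval_pow, Polynomial.eval_sub, Polynomial.eval_C, Polynomial.eval_X,
          Polynomial.eval_one]
        linear_combination (-(z ^ 2 + 1)) * this
          - (z ^ 2 + 1) * (r.eval z) ^ 2 * (q.eval z) ^ 2 * Complex.I_sq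
    have hX : (Polynomial.X ^ 2 + 1 : Polynomial ℂ) ≠ 0 := by
      intro h
      have := congrArg (Polynomial.eval 0) h
      simp at this
    have fin : ∀ c : ℂ, c ≠ 0 → p ≠ Polynomial.C c * q := by
      intro c hc hp
      apply mul_ne_zero hq hr0
      apply Polynomial.funext
      intro z
      have := hodd z
      simp only [hp, Polynomial.eval_mul, Polynomial.eval_C] at this
      simp only [Polynomial.eval_mul, hre, Polynomial.eval_zero]
      have h2 : c * (2 * (q.eval z * q.eval (-z))) = 0 := by linear_combination this
      simpa [hc] using h2
    rcases mul_eq_zero.mp ((mul_eq_zero.mp ((mul_eq_zero.mp key).resolve_right hX)).resolve_left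
      (pow_ne_zero 2 hr0)) with h | h
    · apply fin (-Complex.I) (by simp)
      rw [Polynomial.C_neg]
      linear_combination h
    · apply fin Complex.I (by simp)
      linear_combination h
  · intro z hz _
    have a := hP z hz
    have b := hQ z hz
    simp only [Polynomial.eval_add, Polynomial.eval_sub, Polynomial.eval_mul,
      Polynomial.eval_pow] at a b
    apply mul_right_cancel₀ (pow_ne_zero (max N1 N2) hz)
    linear_combination (p.eval z ^ 2 - q.eval z ^ 2) * b - (p.eval z ^ 2 + q.eval z ^ 2) * a
end

section
/- Let p, q be coprime complex polynomials with q ≠ 0, set f(z) = p(z)/q(z), and suppose the image of the upper half plane U under f equals U (f(U) = U). Suppose further that there exist complex polynomials P, Q, not both zero, such that for every z ∈ ℂ with z² + 1 ≠ 0 and q(z) ≠ 0, writing w = (z² - 1)/(z² + 1), one has (p(z)² - q(z)²)·Q(w) = P(w)·(p(z)² + q(z)²) (i.e. φ ∘ f = f̃ ∘ φ for the rational function f̃ = P/Q, where φ(z) = (z² - 1)/(z² + 1)). Then f is odd: p(-z)·q(z) = -p(z)·q(-z) for all z ∈ ℂ. -/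
open Polynomial in
theorem aux_finite (R : ℂ[X]) (hR : R ≠ 0) :
    {t : ℝ | 0 < t ∧ R.eval ((((t : ℂ)) ^ 2 - 1) / ((t : ℂ) ^ 2 + 1)) = 0}.Finite := by
  apply Set.Finite.of_finite_image (f := fun t : ℝ => (((t : ℂ)) ^ 2 - 1) / ((t : ℂ) ^ 2 + 1))
  · apply (Polynomial.finite_setOf_isRoot hR).subset
    rintro _ ⟨t, ht, rfl⟩
    exact ht.2
  · intro s hs t ht h
    have hs0 : (0 : ℝ) < s := hs.1
    have ht0 : (0 : ℝ) < t := ht.1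
    have h' : (s ^ 2 - 1) / (s ^ 2 + 1) = (t ^ 2 - 1) / (t ^ 2 + 1) := by
      simp only at h
      exact_mod_cast h
    have h1 : s ^ 2 + 1 ≠ 0 := by positivity
    have h2 : t ^ 2 + 1 ≠ 0 := by positivity
    rw [div_eq_div_iff h1 h2] at h'
    have : s ^ 2 = t ^ 2 := by linarith
    exact (pow_left_inj₀ hs0.le ht0.le two_ne_zero).1 this

open Polynomial in
theorem aux_pole (p q : ℂ[X]) (hcop : IsCoprime p q) (z : ℂ) (h1 : p.eval z = 0)
    (h2 : q.eval z = 0) : False := by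
  obtain ⟨a, b, h⟩ := hcop
  have := congrArg (Polynomial.eval z) h
  simp [h1, h2] at this

open Polynomial in
theorem aux_const (p q : ℂ[X]) (hcop : IsCoprime p q)
    (hpos : ∀ z : ℂ, z.im ≠ 0 → q.eval z ≠ 0 ∧ 0 < (p.eval z / q.eval z).im)
    (w : ℂ) (hw : w.im < 0) : (p - C w * q).degree ≤ 0 := by
  by_contra hdeg
  obtain ⟨z, hz⟩ := Complex.exists_root (not_le.1 hdeg)
  have hz' : p.eval z = w * q.eval z := by
    have : p.eval z - w * q.eval z = 0 := by simpa [IsRoot] using hz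
    linear_combination this
  have hqz : q.eval z ≠ 0 := fun h => aux_pole p q hcop z (by simp [hz', h]) h
  have hc : ContinuousAt (fun y : ℝ => (p.eval (z + y * Complex.I) / q.eval (z + y * Complex.I)).im)
      0 := by
    apply Complex.continuous_im.continuousAt.comp
    apply ContinuousAt.div
    · fun_prop
    · fun_prop
    · simpa using hqz
  have hlt : (fun y : ℝ => (p.eval (z + y * Complex.I) / q.eval (z + y * Complex.I)).im) 0 < 0 := by
    simpa [hz', hqz] using hw
  have hev := (hc.eventually (gt_mem_nhds hlt))
  have hne : ∀ᶠ y : ℝ in nhdsWithin 0 {0}ᶜ, z.im + y ≠ 0 := by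
    by_cases h0 : z.im = 0
    · filter_upwards [self_mem_nhdsWithin] with y hy
      simpa [h0] using hy
    · apply Filter.Eventually.filter_mono nhdsWithin_le_nhds
      have : ContinuousAt (fun y : ℝ => z.im + y) 0 := by fun_prop
      exact this.eventually_ne (by simpa using h0)
  obtain ⟨y, hy1, hy2⟩ := ((hev.filter_mono nhdsWithin_le_nhds).and hne).exists
  have := (hpos (z + y * Complex.I) (by simpa using hy2)).2
  linarith

/-- If `f = p/q` maps the upper half plane onto itself and is semi-conjugated
by `φ(z) = (z² - 1)/(z² + 1)` to some rational map `f̃ = P/Q`, then `f` is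
odd. -/
theorem semiconjugate_implies_odd
    (p q : Polynomial ℂ) (hq : q ≠ 0) (hcop : IsCoprime p q)
    (himg : (fun z : ℂ => p.eval z / q.eval z) '' {z : ℂ | 0 < z.im}
      = {z : ℂ | 0 < z.im})
    (hconj : ∃ (P Q : Polynomial ℂ), ¬(P = 0 ∧ Q = 0) ∧
      ∀ z : ℂ, z ^ 2 + 1 ≠ 0 → q.eval z ≠ 0 →
        (p.eval z ^ 2 - q.eval z ^ 2) * Q.eval ((z ^ 2 - 1) / (z ^ 2 + 1))
          = P.eval ((z ^ 2 - 1) / (z ^ 2 + 1)) * (p.eval z ^ 2 + q.eval z ^ 2)) :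
    ∀ z : ℂ, p.eval (-z) * q.eval z = -(p.eval z * q.eval (-z)) := by
  obtain ⟨P, Q, hPQ, hc⟩ := hconj
  have hU : ∀ z : ℂ, 0 < z.im → q.eval z ≠ 0 ∧ 0 < (p.eval z / q.eval z).im := by
    intro z hz
    have h : p.eval z / q.eval z ∈ {z : ℂ | 0 < z.im} := himg ▸ ⟨z, hz, rfl⟩
    have h' : 0 < (p.eval z / q.eval z).im := h
    refine ⟨fun h0 => ?_, h'⟩
    simp [h0] at h'
  let p' := p.comp (-Polynomial.X)
  let q' := q.comp (-Polynomial.X)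
  have hp' : ∀ z, p'.eval z = p.eval (-z) := fun z => by simp [p']
  have hq' : ∀ z, q'.eval z = q.eval (-z) := fun z => by simp [q']
  have hq'0 : q' ≠ 0 := by
    intro h
    have := hq' (-Complex.I)
    rw [h] at this
    exact (hU Complex.I (by simp)).1 (by simpa using this.symm)
  obtain ⟨R, hR, hRc⟩ : ∃ R : Polynomial ℂ, R ≠ 0 ∧ ∀ z : ℂ, z ^ 2 + 1 ≠ 0 → q.eval z ≠ 0 →
      q.eval (-z) ≠ 0 → R.eval ((z ^ 2 - 1) / (z ^ 2 + 1)) *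
        ((p.eval z * q.eval (-z)) ^ 2 - (p.eval (-z) * q.eval z) ^ 2) = 0 := by
    by_cases hP : P = 0
    · refine ⟨Q, fun h => hPQ ⟨hP, h⟩, fun z h1 h2 h3 => ?_⟩
      have e1 := hc z h1 h2
      have e2 := hc (-z) (by simpa using h1) h3
      rw [neg_sq] at e2
      linear_combination (1 / 2) * (p.eval (-z) ^ 2 + q.eval (-z) ^ 2) * e1
        - (1 / 2) * (p.eval z ^ 2 + q.eval z ^ 2) * e2
    · refine ⟨P, hP, fun z h1 h2 h3 => ?_⟩
      have e1 := hc z h1 h2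
      have e2 := hc (-z) (by simpa using h1) h3
      rw [neg_sq] at e2
      linear_combination (1 / 2) * (p.eval (-z) ^ 2 - q.eval (-z) ^ 2) * e1
        - (1 / 2) * (p.eval z ^ 2 - q.eval z ^ 2) * e2
  have hD : (p * q' - p' * q) * (p * q' + p' * q) = 0 := by
    apply Polynomial.eq_zero_of_infinite_isRoot
    have hfin2 : {t : ℝ | (q * q').eval (t : ℂ) = 0}.Finite :=
      Set.Finite.preimage (Complex.ofReal_injective.injOn)
        (Polynomial.finite_setOf_isRoot (mul_ne_zero hq hq'0))
    have hinf : (Set.Ioi (0 : ℝ) \ ({t : ℝ | 0 < t ∧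
        R.eval ((((t : ℂ)) ^ 2 - 1) / ((t : ℂ) ^ 2 + 1)) = 0} ∪
        {t : ℝ | (q * q').eval (t : ℂ) = 0})).Infinite :=
      (Set.Ioi_infinite 0).diff ((aux_finite R hR).union hfin2)
    refine (hinf.image (Complex.ofReal_injective.injOn)).mono ?_
    rintro _ ⟨t, ⟨ht0, ht⟩, rfl⟩
    have ht0' : (0 : ℝ) < t := ht0
    simp only [Set.mem_union, Set.mem_setOf_eq, not_or, not_and, Polynomial.eval_mul,
      mul_eq_zero, hq'] at ht
    have h1 : (t : ℂ) ^ 2 + 1 ≠ 0 := by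
      have : t ^ 2 + 1 ≠ 0 := by positivity
      exact_mod_cast this
    have := (mul_eq_zero.1 (hRc t h1 ht.2.1 ht.2.2)).resolve_left (ht.1 ht0')
    simp only [Set.mem_setOf_eq, Polynomial.IsRoot, Polynomial.eval_mul, Polynomial.eval_sub,
      Polynomial.eval_add, hp', hq']
    linear_combination this
  rcases mul_eq_zero.1 hD with h | h
  · exfalso
    have he : ∀ z, p.eval z * q.eval (-z) = p.eval (-z) * q.eval z := by
      intro z
      have := congrArg (Polynomial.eval z) h
      simp only [Polynomial.eval_mul, Polynomial.eval_sub, hp', hq', Polynomial.eval_zero] at this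
      linear_combination this
    have hpos : ∀ z : ℂ, z.im ≠ 0 → q.eval z ≠ 0 ∧ 0 < (p.eval z / q.eval z).im := by
      intro z hz
      rcases lt_or_gt_of_ne hz with hz | hz
      · have h1 := hU (-z) (by simpa using hz)
        have h2 : q.eval z ≠ 0 := by
          intro h0
          have := he z
          rw [h0, mul_zero] at this
          exact aux_pole p q hcop z ((mul_eq_zero.1 this).resolve_right h1.1) h0
        refine ⟨h2, ?_⟩
        rw [(div_eq_div_iff h2 h1.1).2 (he z)]
        exact h1.2
      · exact hU z hz
    have c1 := Polynomial.eq_C_of_degree_le_zero (aux_const p q hcop hpos (-Complex.I) (by simp))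
    have c2 := Polynomial.eq_C_of_degree_le_zero
      (aux_const p q hcop hpos (-(2 * Complex.I)) (by simp))
    have hconst : ∀ z, p.eval z = p.eval 0 ∧ q.eval z = q.eval 0 := by
      intro z
      have a1 := congrArg (Polynomial.eval z) c1
      have a2 := congrArg (Polynomial.eval z) c2
      have b1 := congrArg (Polynomial.eval 0) c1
      have b2 := congrArg (Polynomial.eval 0) c2
      simp only [Polynomial.eval_sub, Polynomial.eval_mul, Polynomial.eval_C] at a1 a2 b1 b2
      have hqq : q.eval z = q.eval 0 := by
        apply mul_left_cancel₀ Complex.I_ne_zero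
        linear_combination a2 - a1 - b2 + b1
      refine ⟨?_, hqq⟩
      linear_combination a1 - b1 - Complex.I * hqq
    have i1 : Complex.I ∈ (fun z : ℂ => p.eval z / q.eval z) '' {z : ℂ | 0 < z.im} := by
      rw [himg]; simp
    have i2 : 2 * Complex.I ∈ (fun z : ℂ => p.eval z / q.eval z) '' {z : ℂ | 0 < z.im} := by
      rw [himg]; simp
    obtain ⟨z1, -, h1⟩ := i1
    obtain ⟨z2, -, h2⟩ := i2
    simp only [(hconst z1).1, (hconst z1).2] at h1
    simp only [(hconst z2).1, (hconst z2).2] at h2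
    have := congrArg Complex.im (h1.symm.trans h2)
    norm_num at this
  · intro z
    have := congrArg (Polynomial.eval z) h
    simp only [Polynomial.eval_mul, Polynomial.eval_add, hp', hq', Polynomial.eval_zero] at this
    linear_combination this
end

section
/- Let X and Y be topological spaces, let I be an index set, let h_j : X → X and g_j : Y → Y for j ∈ I be families of maps, and let k : X → Y be continuous and surjective with k ∘ h_j = g_j ∘ k for every j ∈ I. Define E_h to be the intersection of all subsets S of X that are closed, contain at least three points, and are completely invariant under h_j for every j ∈ I; define E_g analogously in Y using the maps g_j. If E_g contains at least three points, then k(E_h) ⊆ E_g. -/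
/-- If `k` is continuous and surjective and semi-conjugates the families
`h_j` to `g_j`, then `k(E_h) ⊆ E_g`, where `E_h`, `E_g` are the completely
invariant Julia sets (provided `E_g` has at least three points). -/
theorem image_of_completely_invariant_julia_subset
    {X Y : Type*} [TopologicalSpace X] [TopologicalSpace Y] {I : Type*}
    (h : I → X → X) (g : I → Y → Y) (k : X → Y)
    (hk : Continuous k) (hsurj : Function.Surjective k)
    (hconj : ∀ j : I, k ∘ h j = g j ∘ k)
    (Eh : Set X)
    (hEh : Eh = ⋂₀ {S : Set X | IsClosed S ∧ 3 ≤ S.encard ∧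
      ∀ j : I, h j '' S ⊆ S ∧ h j ⁻¹' S ⊆ S})
    (Eg : Set Y)
    (hEg : Eg = ⋂₀ {S : Set Y | IsClosed S ∧ 3 ≤ S.encard ∧
      ∀ j : I, g j '' S ⊆ S ∧ g j ⁻¹' S ⊆ S})
    (hcard : 3 ≤ Eg.encard) :
    k '' Eh ⊆ Eg := by
  subst hEh hEg
  rintro _ ⟨x, hx, rfl⟩ S ⟨hc, h3, hinv⟩
  have hj : ∀ j y, k (h j y) = g j (k y) := fun j y => congrFun (hconj j) y
  refine hx (k ⁻¹' S) ⟨hc.preimage hk, ?_, fun j => ⟨?_, ?_⟩⟩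
  · calc (3 : ℕ∞) ≤ S.encard := h3
      _ = (k '' (k ⁻¹' S)).encard := by rw [Set.image_preimage_eq S hsurj]
      _ ≤ _ := Set.encard_image_le _ _
  · rintro _ ⟨y, hy, rfl⟩
    change k (h j y) ∈ S
    rw [hj]
    exact (hinv j).1 ⟨k y, hy, rfl⟩
  · intro y hy
    have hy' : k (h j y) ∈ S := hy
    rw [hj] at hy'
    exact (hinv j).2 hy'
end

section
/- Let X and Y be topological spaces, let I be an index set, let h_j : X → X and g_j : Y → Y for j ∈ I be families of maps, and let k : X → Y be a continuous, surjective, closed map with k ∘ h_j = g_j ∘ k for every j ∈ I. Define E_h to be the intersection of all subsets S of X that are closed, contain at least three points, and are completely invariant under h_j for every j ∈ I; define E_g analogously in Y using the maps g_j. Suppose that E_g contains at least three points, that k⁻¹(k(E_h)) = E_h, and that k(E_h) contains at least three points. Then k(E_h) = E_g. -/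
/-- If in addition `k` is a closed map, `k⁻¹(k(E_h)) = E_h`, and `k(E_h)` has
at least three points, then `k(E_h) = E_g`. -/
theorem image_of_completely_invariant_julia_eq
    {X Y : Type*} [TopologicalSpace X] [TopologicalSpace Y] {I : Type*}
    (h : I → X → X) (g : I → Y → Y) (k : X → Y)
    (hk : Continuous k) (hsurj : Function.Surjective k) (hclosed : IsClosedMap k)
    (hconj : ∀ j : I, k ∘ h j = g j ∘ k)
    (Eh : Set X)
    (hEh : Eh = ⋂₀ {S : Set X | IsClosed S ∧ 3 ≤ S.encard ∧
      ∀ j : I, h j '' S ⊆ S ∧ h j ⁻¹' S ⊆ S})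
    (Eg : Set Y)
    (hEg : Eg = ⋂₀ {S : Set Y | IsClosed S ∧ 3 ≤ S.encard ∧
      ∀ j : I, g j '' S ⊆ S ∧ g j ⁻¹' S ⊆ S})
    (hcardg : 3 ≤ Eg.encard)
    (hsat : k ⁻¹' (k '' Eh) = Eh)
    (hcardh : 3 ≤ (k '' Eh).encard) :
    k '' Eh = Eg := by
  have hc : ∀ j x, k (h j x) = g j (k x) := fun j x => congrFun (hconj j) x
  have hEclosed : IsClosed Eh := by
    rw [hEh]
    exact isClosed_sInter fun S hS => hS.1
  have hfwd : ∀ j x, x ∈ Eh → h j x ∈ Eh := by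
    intro j x hx
    rw [hEh] at hx ⊢
    intro S hS
    exact (hS.2.2 j).1 ⟨x, hx S hS, rfl⟩
  have hbwd : ∀ j x, h j x ∈ Eh → x ∈ Eh := by
    intro j x hx
    rw [hEh] at hx ⊢
    intro S hS
    exact (hS.2.2 j).2 (hx S hS)
  apply Set.Subset.antisymm
  · rintro _ ⟨x, hx, rfl⟩
    rw [hEg]
    intro S hS
    rw [hEh] at hx
    refine hx (k ⁻¹' S) ⟨hS.1.preimage hk, ?_, fun j => ⟨?_, ?_⟩⟩
    · have h1 := Set.encard_image_le k (k ⁻¹' S)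
      rw [Set.image_preimage_eq S hsurj] at h1
      exact hS.2.1.trans h1
    · rintro _ ⟨z, hz, rfl⟩
      change k (h j z) ∈ S
      rw [hc]
      exact (hS.2.2 j).1 ⟨k z, hz, rfl⟩
    · intro z hz
      change k (h j z) ∈ S at hz
      rw [hc] at hz
      exact (hS.2.2 j).2 hz
  · intro y hy
    rw [hEg] at hy
    refine hy (k '' Eh) ⟨hclosed _ hEclosed, hcardh, fun j => ⟨?_, ?_⟩⟩
    · rintro _ ⟨_, ⟨x, hx, rfl⟩, rfl⟩
      exact ⟨h j x, hfwd j x hx, hc j x⟩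
    · intro z hz
      obtain ⟨x, rfl⟩ := hsurj z
      change g j (k x) ∈ k '' Eh at hz
      rw [← hc] at hz
      have h2 : h j x ∈ k ⁻¹' (k '' Eh) := hz
      rw [hsat] at h2
      exact ⟨x, hbwd j x h2, rfl⟩
end

section
/- The preimage of the real segment [-2, 2] under the complex polynomial map z ↦ 4z² - 2 equals the real segment [-1, 1]; that is, {z ∈ ℂ : 4z² - 2 = x for some real x with -2 ≤ x ≤ 2} = {z ∈ ℂ : z = t for some real t with -1 ≤ t ≤ 1}. In particular, g(z) = 4z² - 2 maps [-1, 1] onto [-2, 2] and the segment [-1, 1] is backward invariant under g. -/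
/-- The preimage of the real segment `[-2, 2]` under `z ↦ 4z² - 2` equals the
real segment `[-1, 1]` in the complex plane. -/
theorem preimage_segment_4zsq_sub_two :
    {z : ℂ | ∃ x : ℝ, 4 * z ^ 2 - 2 = (x : ℂ) ∧ -2 ≤ x ∧ x ≤ 2}
      = {z : ℂ | ∃ t : ℝ, z = (t : ℂ) ∧ -1 ≤ t ∧ t ≤ 1} := by
  ext z
  simp only [Set.mem_setOf_eq]
  constructor
  · rintro ⟨x, hx, h1, h2⟩
    have hre := congrArg Complex.re hx
    have him := congrArg Complex.im hx
    simp [pow_two] at hre him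
    have hab : z.re * z.im = 0 := by linarith
    have hb : z.im = 0 := by
      rcases mul_eq_zero.mp hab with h | h
      · rw [h] at hre
        have : z.im * z.im = 0 := by nlinarith [mul_self_nonneg z.im]
        exact mul_self_eq_zero.mp this
      · exact h
    rw [hb] at hre
    refine ⟨z.re, ?_, by nlinarith, by nlinarith⟩
    apply Complex.ext <;> simp [hb]
  · rintro ⟨t, rfl, h1, h2⟩
    exact ⟨4 * t ^ 2 - 2, by push_cast; ring, by nlinarith [sq_nonneg t], by nlinarith⟩
end

section
/- The map f(z) = 2z - 1/z maps the upper half plane U onto itself: {2z - 1/z : z ∈ U} = U. -/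
/-- The imaginary part of `2z - 1/z`. -/
lemma im_formula_aux (z : ℂ) :
    (2 * z - 1 / z).im = z.im * (2 + 1 / Complex.normSq z) := by
  simp [Complex.inv_im]
  ring

/-- The map preserves the sign of the imaginary part. -/
lemma im_pos_iff_aux (z : ℂ) : 0 < (2 * z - 1 / z).im ↔ 0 < z.im := by
  have h : 0 < 2 + 1 / Complex.normSq z := by
    have := Complex.normSq_nonneg z
    positivity
  rw [im_formula_aux]
  exact mul_pos_iff_of_pos_right h

/-- The map `f(z) = 2z - 1/z` maps the upper half plane onto itself. -/
theorem two_z_sub_inv_maps_upper_half_plane_onto :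
    (fun z : ℂ => 2 * z - 1 / z) '' {z : ℂ | 0 < z.im} = {z : ℂ | 0 < z.im} := by
  ext w
  simp only [Set.mem_image, Set.mem_setOf_eq]
  constructor
  · rintro ⟨z, hz, rfl⟩
    exact (im_pos_iff_aux z).2 hz
  · intro hw
    obtain ⟨s, hs⟩ := IsAlgClosed.exists_pow_nat_eq (w ^ 2 + 8) (n := 2) (by norm_num)
    obtain ⟨z, hz⟩ : ∃ z : ℂ, z = (w + s) / 4 := ⟨_, rfl⟩
    have hq : 2 * z ^ 2 - w * z - 1 = 0 := by
      rw [hz]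
      linear_combination hs / 8
    have h0 : z ≠ 0 := by
      rintro rfl
      norm_num at hq
    have hf : 2 * z - 1 / z = w := by
      field_simp
      linear_combination hq
    exact ⟨z, (im_pos_iff_aux z).1 (hf ▸ hw), hf⟩
end
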